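/- Karma is online strategy-proof even against coalitions: let S be a set of colluding users and suppose all users report their true demands during quanta 1, …, q−1 (so both runs have identical cumulative allocations R_k^{q−1} entering quantum q). If at quantum q each user i ∈ S reports an arbitrary demand d̂_i^q ≥ 0 while every user outside S reports truthfully, then the coalition's useful allocation at quantum q does not exceed its truthful allocation: Σ_{i∈S} min(r̂_i^q, d_i^q) ≤ Σ_{i∈S} r_i^q, where r^q and r̂^q are the Karma step allocations at quantum q under truthful and deviating reports respectively. -/

import Mathlib

open Finset

/-- One step of the Karma algorithm with instantaneous guarantee `α = 0`
(assuming no user runs out of credits): from prior cumulative allocations `R`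
and reported demands `d`, each user `k` is allocated
`r k = min (d k) ((lam - R k)⁺)`, where the water level `lam ≥ 0` is such that
`∑ k, r k = min C (∑ k, d k)`. -/
def KarmaStep (n : ℕ) (C : ℝ) (R d r : Fin n → ℝ) : Prop :=
  ∃ lam : ℝ, 0 ≤ lam ∧ (∀ k, r k = min (d k) (max (lam - R k) 0)) ∧
    (∑ k, r k) = min C (∑ k, d k)

/-- Cumulative allocation of user `k` before quantum `t` (quanta are 0-based):
`cum n r t k = ∑_{τ < t} r τ k`. -/
def cum (n : ℕ) (r : ℕ → Fin n → ℝ) (t : ℕ) (k : Fin n) : ℝ :=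
  ∑ τ ∈ Finset.range t, r τ k

/-- A run of the Karma algorithm over quanta `0, 1, 2, …` with reported
demands `d t` and allocations `r t`, starting from zero cumulative
allocations. -/
def KarmaRun (n : ℕ) (C : ℝ) (d r : ℕ → Fin n → ℝ) : Prop :=
  ∀ t, KarmaStep n C (cum n r t) (d t) (r t)

/-- With equal reports, a higher water level gives every user at least as much. -/
theorem karma_alloc_mono {n : ℕ} {R d r r' : Fin n → ℝ} {lam lam' : ℝ}
    (hr : ∀ k, r k = min (d k) (max (lam - R k) 0))
    (hr' : ∀ k, r' k = min (d k) (max (lam' - R k) 0)) (h : lam ≤ lam') (k : Fin n) :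
    r k ≤ r' k := by
  rw [hr, hr']
  gcongr

/-- The Karma step allocation is unique. -/
theorem KarmaStep.unique {n : ℕ} {C : ℝ} {R d r r' : Fin n → ℝ}
    (h : KarmaStep n C R d r) (h' : KarmaStep n C R d r') : r = r' := by
  obtain ⟨lam, -, hr, hsum⟩ := h
  obtain ⟨lam', -, hr', hsum'⟩ := h'
  have hs : ∑ k, r k = ∑ k, r' k := hsum.trans hsum'.symm
  funext k
  rcases le_total lam lam' with hl | hl
  · exact (Finset.sum_eq_sum_iff_of_le fun k _ => karma_alloc_mono hr hr' hl k).1 hs k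
      (Finset.mem_univ k)
  · exact ((Finset.sum_eq_sum_iff_of_le fun k _ => karma_alloc_mono hr' hr hl k).1 hs.symm k
      (Finset.mem_univ k)).symm

/-- Runs whose reports agree before quantum `q` have the same allocations before `q`. -/
theorem KarmaRun.eq_of_reports_eq {n : ℕ} {C : ℝ} {d d' r r' : ℕ → Fin n → ℝ}
    (h : KarmaRun n C d r) (h' : KarmaRun n C d' r') {q : ℕ}
    (hd : ∀ t, t < q → d' t = d t) : ∀ t, t < q → r' t = r t := by
  intro t
  induction t using Nat.strong_induction_on with
  | _ t ih =>
    intro ht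
    have hcum : cum n r' t = cum n r t := by
      funext k
      refine Finset.sum_congr rfl fun τ hτ => ?_
      have hτt := Finset.mem_range.1 hτ
      rw [ih τ hτt (hτt.trans ht)]
    have hstep := h' t
    rw [hcum, hd t ht] at hstep
    exact hstep.unique (h t)

/-- In a single Karma step, a coalition cannot increase its useful allocation by misreporting. -/
theorem KarmaStep.sum_min_le {n : ℕ} {C : ℝ} {R d d' r r' : Fin n → ℝ} {S : Finset (Fin n)}
    (h : KarmaStep n C R d r) (h' : KarmaStep n C R d' r') (hd : ∀ k, k ∉ S → d' k = d k) :
    ∑ i ∈ S, min (r' i) (d i) ≤ ∑ i ∈ S, r i := by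
  obtain ⟨lam, -, hr, hsum⟩ := h
  obtain ⟨lam', -, hr', hsum'⟩ := h'
  rcases le_total lam' lam with hl | hl
  · refine Finset.sum_le_sum fun i _ => ?_
    rw [hr i, min_comm]
    gcongr
    rw [hr' i]
    exact (min_le_right _ _).trans (by gcongr)
  rcases le_total C (∑ k, d k) with hC | hC
  · rw [min_eq_left hC] at hsum
    have htotal : ∑ k, r' k ≤ C := hsum'.trans_le (min_le_left _ _)
    have hout : ∑ k ∈ Sᶜ, r k ≤ ∑ k ∈ Sᶜ, r' k := by
      refine Finset.sum_le_sum fun k hk => ?_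
      rw [hr, hr', hd k (Finset.mem_compl.1 hk)]
      gcongr
    have hmin : ∑ i ∈ S, min (r' i) (d i) ≤ ∑ i ∈ S, r' i :=
      Finset.sum_le_sum fun i _ => min_le_left _ _
    have hsplit := Finset.sum_add_sum_compl S r
    have hsplit' := Finset.sum_add_sum_compl S r'
    linarith
  · rw [min_eq_right hC] at hsum
    have heq := (Finset.sum_eq_sum_iff_of_le fun k _ =>
      (hr k).trans_le (min_le_left _ _)).1 hsum
    refine Finset.sum_le_sum fun i _ => ?_
    rw [heq i (Finset.mem_univ i)]
    exact min_le_right _ _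

/-- (Online strategy-proofness against coalitions.) Let `S` be a set of
colluding users and suppose all users report their true demands during quanta
`0, …, q - 1` (so the two runs have identical reported demands, and hence
identical cumulative allocations, entering quantum `q`). If at quantum `q`
each user `i ∈ S` reports an arbitrary nonnegative demand while every user
outside `S` reports truthfully, then the coalition's useful allocation at
quantum `q` does not exceed its truthful allocation at quantum `q`. -/
theorem karma_coalition_online_strategy_proof (n : ℕ) (C : ℝ) (hC : 0 < C)
    (S : Finset (Fin n)) (d dh r rh : ℕ → Fin n → ℝ)
    (hd : ∀ t k, 0 ≤ d t k) (hdh : ∀ t k, 0 ≤ dh t k)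
    (q : ℕ)
    (hhist : ∀ t, t < q → ∀ k, dh t k = d t k)
    (hsame : ∀ k, k ∉ S → dh q k = d q k)
    (hrun : KarmaRun n C d r) (hrunh : KarmaRun n C dh rh) :
    (∑ i ∈ S, min (rh q i) (d q i)) ≤ ∑ i ∈ S, r q i := by
  have hpast := hrun.eq_of_reports_eq hrunh fun t ht => funext (hhist t ht)
  have hcum : cum n rh q = cum n r q := by
    funext k
    refine Finset.sum_congr rfl fun τ hτ => ?_
    rw [hpast τ (Finset.mem_range.1 hτ)]
  have hstep := hrunh q
  rw [hcum] at hstep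
  exact (hrun q).sum_min_le hstep hsame
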